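/- Let (X, 𝒜, μ) be a measure space, let p, q : X → ℝ be measurable functions with p ≥ 0, q ≥ 0, ∫ p dμ = 1 and ∫ q dμ = 1, and let w_r, w_f > 0 be real numbers. Let D : X → ℝ be measurable with 0 < D(x) < 1 for all x, and define D* : X → ℝ by D*(x) = w_r·p(x)/(w_r·p(x) + w_f·q(x)) if w_r·p(x) + w_f·q(x) > 0 and D*(x) = 1/2 otherwise. Assume the functions x ↦ p(x)·log(D(x)), x ↦ q(x)·log(1 − D(x)), x ↦ p(x)·log(D*(x)), and x ↦ q(x)·log(1 − D*(x)) are μ-integrable. Then w_r·∫ p·log(D) dμ + w_f·∫ q·log(1 − D) dμ ≤ w_r·∫ p·log(D*) dμ + w_f·∫ q·log(1 − D*) dμ. -/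

import Mathlib

open MeasureTheory

theorem mul_log_le_mul_log_div_add {a s d : ℝ} (ha : 0 ≤ a) (hs : 0 < s) (hd : 0 < d) :
    a * Real.log d ≤ a * Real.log (a / s) + (s * d - a) := by
  rcases ha.eq_or_lt with rfl | ha
  · simp only [zero_mul, zero_add, sub_zero]
    positivity
  · have h := mul_le_mul_of_nonneg_left
      (Real.log_le_sub_one_of_pos (show 0 < d / (a / s) by positivity)) ha.le
    rw [Real.log_div hd.ne' (by positivity)] at h
    have e : a * (d / (a / s) - 1) = s * d - a := by field_simp
    linarith

theorem mul_log_add_mul_log_one_sub_le {a b d : ℝ} (ha : 0 ≤ a) (hb : 0 ≤ b)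
    (hab : 0 < a + b) (hd0 : 0 < d) (hd1 : d < 1) :
    a * Real.log d + b * Real.log (1 - d) ≤
      a * Real.log (a / (a + b)) + b * Real.log (1 - a / (a + b)) := by
  have h1 := mul_log_le_mul_log_div_add ha hab hd0
  have h2 := mul_log_le_mul_log_div_add hb hab (sub_pos.2 hd1)
  have e : 1 - a / (a + b) = b / (a + b) := by field_simp; ring
  rw [e]
  linarith

theorem weighted_objective_maximized {X : Type*} [MeasurableSpace X] (μ : Measure X)
    (p q : X → ℝ) (hpm : Measurable p) (hqm : Measurable q)
    (hp0 : ∀ x, 0 ≤ p x) (hq0 : ∀ x, 0 ≤ q x)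
    (hpi : ∫ x, p x ∂μ = 1) (hqi : ∫ x, q x ∂μ = 1)
    (wr wf : ℝ) (hwr : 0 < wr) (hwf : 0 < wf)
    (D : X → ℝ) (hDm : Measurable D) (hD01 : ∀ x, 0 < D x ∧ D x < 1)
    (Dstar : X → ℝ)
    (hDstar : ∀ x, Dstar x =
      if 0 < wr * p x + wf * q x then wr * p x / (wr * p x + wf * q x) else 1 / 2)
    (h1 : Integrable (fun x => p x * Real.log (D x)) μ)
    (h2 : Integrable (fun x => q x * Real.log (1 - D x)) μ)
    (h3 : Integrable (fun x => p x * Real.log (Dstar x)) μ)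
    (h4 : Integrable (fun x => q x * Real.log (1 - Dstar x)) μ) :
    wr * ∫ x, p x * Real.log (D x) ∂μ + wf * ∫ x, q x * Real.log (1 - D x) ∂μ ≤
      wr * ∫ x, p x * Real.log (Dstar x) ∂μ +
        wf * ∫ x, q x * Real.log (1 - Dstar x) ∂μ := by
  simp only [← integral_const_mul]
  rw [← integral_add (h1.const_mul wr) (h2.const_mul wf),
    ← integral_add (h3.const_mul wr) (h4.const_mul wf)]
  refine integral_mono ((h1.const_mul wr).add (h2.const_mul wf))
    ((h3.const_mul wr).add (h4.const_mul wf)) fun x => ?_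
  have ha : 0 ≤ wr * p x := mul_nonneg hwr.le (hp0 x)
  have hb : 0 ≤ wf * q x := mul_nonneg hwf.le (hq0 x)
  simp only [← mul_assoc]
  by_cases h : 0 < wr * p x + wf * q x
  · rw [hDstar x, if_pos h]
    exact mul_log_add_mul_log_one_sub_le ha hb h (hD01 x).1 (hD01 x).2
  · have ha0 : wr * p x = 0 := by linarith
    have hb0 : wf * q x = 0 := by linarith
    simp [ha0, hb0]
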